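/- Let a ≥ 0 and let f : [0,∞) → ℝ be continuous with |f(x)| ≤ M·(1+x²) for all x ≥ 0 and such that lim_{x→∞} f(x)/(1+x²) exists. Then lim_{n→∞} ‖K_n^a(f) − f‖_ρ = 0, where ‖g‖_ρ = sup_{x∈[0,∞)} |g(x)|/(1+x²). -/

import Mathlib

open MeasureTheory Filter

noncomputable section

/-- Rising factorial `(n)_i = n(n+1)⋯(n+i-1)`, with `(n)_0 = 1`. -/
def risingFac (n : ℕ) : ℕ → ℝ
  | 0 => 1
  | i + 1 => risingFac n i * ((n : ℝ) + i)

/-- `P_k(n,a) = Σ_{i=0}^{k} C(k,i) (n)_i a^(k-i)`. -/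
def Pba (k n : ℕ) (a : ℝ) : ℝ :=
  ∑ i ∈ Finset.range (k + 1), (k.choose i : ℝ) * risingFac n i * a ^ (k - i)

/-- Generalized Baskakov basis function `W_{n,k}^a(x)`. -/
def Wgb (a : ℝ) (n k : ℕ) (x : ℝ) : ℝ :=
  Real.exp (-(a * x) / (1 + x)) * (Pba k n a / (Nat.factorial k : ℝ)) * x ^ k /
    (1 + x) ^ (n + k)

/-- Generalized Baskakov–Kantorovich operator `K_n^a(f;x)`. -/
def Kgb (a : ℝ) (n : ℕ) (f : ℝ → ℝ) (x : ℝ) : ℝ :=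
  ((n : ℝ) + 1) * ∑' k : ℕ,
    Wgb a n k x * ∫ t in ((k : ℝ) / ((n : ℝ) + 1))..(((k : ℝ) + 1) / ((n : ℝ) + 1)), f t


/-- Weighted norm `‖g‖_ρ = sup_{x≥0} |g(x)|/(1+x²)` with weight `ρ(x) = 1+x²`. -/
def rhoNorm (g : ℝ → ℝ) : ℝ :=
  ⨆ x : Set.Ici (0 : ℝ), |g x| / (1 + (x : ℝ) ^ 2)

lemma HasSum.of_eq {u v : ℕ → ℝ} {s t : ℝ} (h : HasSum v t) (huv : ∀ k, u k = v k)
    (hst : s = t) : HasSum u s := by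
  rw [funext huv, hst]
  exact h

lemma risingFac_nonneg (n i : ℕ) : 0 ≤ risingFac n i := by
  induction i with
  | zero => simp [risingFac]
  | succ i ih => simp only [risingFac]; positivity

lemma risingFac_eq_ascFactorial (n i : ℕ) : risingFac n i = (n.ascFactorial i : ℝ) := by
  induction i with
  | zero => simp [risingFac]
  | succ i ih => rw [risingFac, ih, Nat.ascFactorial_succ]; push_cast; ring

lemma risingFac_succ' (n i : ℕ) : risingFac n (i + 1) = n * risingFac (n + 1) i := by
  induction i with
  | zero => simp [risingFac]
  | succ i ih => rw [risingFac, ih, risingFac]; push_cast; ring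

lemma Pba_nonneg {a : ℝ} (ha : 0 ≤ a) (k n : ℕ) : 0 ≤ Pba k n a :=
  Finset.sum_nonneg fun i _ => by have := risingFac_nonneg n i; positivity

lemma Wgb_nonneg {a : ℝ} (ha : 0 ≤ a) (n k : ℕ) {x : ℝ} (hx : 0 ≤ x) : 0 ≤ Wgb a n k x := by
  have := Pba_nonneg ha k n
  unfold Wgb
  positivity

lemma Pba_succ (k n : ℕ) (a : ℝ) :
    Pba (k + 1) n a = n * Pba k (n + 1) a + a * Pba k n a := by
  have h1 : n * Pba k (n + 1) a = ∑ i ∈ Finset.range (k + 1),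
      (k.choose i : ℝ) * risingFac n (i + 1) * a ^ (k - i) := by
    rw [Pba, Finset.mul_sum]
    refine Finset.sum_congr rfl fun i _ => ?_
    rw [risingFac_succ']; ring
  have h2 : a * Pba k n a = ∑ i ∈ Finset.range (k + 2),
      (k.choose i : ℝ) * risingFac n i * a ^ (k + 1 - i) := by
    rw [Finset.sum_range_succ, Pba, Finset.mul_sum]
    simp only [Nat.choose_succ_self, Nat.cast_zero, zero_mul, add_zero]
    refine Finset.sum_congr rfl fun i hi => ?_
    rw [Nat.succ_sub (Nat.lt_succ_iff.mp (Finset.mem_range.mp hi)), pow_succ]; ring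
  rw [h1, h2, Pba, Finset.sum_range_succ', Finset.sum_range_succ' _ (k + 1), ← add_assoc,
    ← Finset.sum_add_distrib]
  simp only [Nat.choose_zero_right]
  congr 1
  refine Finset.sum_congr rfl fun i _ => ?_
  rw [Nat.choose_succ_succ, Nat.add_sub_add_right]; push_cast; ring

/-- The negative binomial series. -/
lemma hasSum_risingFac (n : ℕ) {y : ℝ} (h0 : 0 ≤ y) (h1 : y < 1) :
    HasSum (fun i : ℕ => risingFac n i / i.factorial * y ^ i) ((1 - y) ^ n)⁻¹ := by
  cases n with
  | zero =>
    have : ∀ i : ℕ, i ≠ 0 → risingFac 0 i / i.factorial * y ^ i = 0 := by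
      rintro (_ | i) hi
      · exact absurd rfl hi
      · simp [risingFac_succ']
    simpa [risingFac] using hasSum_single 0 this
  | succ m =>
    have h := hasSum_choose_mul_geometric_of_norm_lt_one m
      (show ‖y‖ < 1 by rwa [Real.norm_of_nonneg h0])
    rw [one_div] at h
    refine h.of_eq (fun i => ?_) rfl
    have : (i.factorial : ℝ) ≠ 0 := by positivity
    rw [risingFac_eq_ascFactorial, Nat.ascFactorial_eq_factorial_mul_choose]
    rw [Nat.add_comm m i, Nat.choose_symm_add]
    push_cast
    field_simp

/-- The generating function of `P_k(n,a)/k!`. -/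
lemma hasSum_Pba (a : ℝ) (n : ℕ) {y : ℝ} (h0 : 0 ≤ y) (h1 : y < 1) :
    HasSum (fun k : ℕ => Pba k n a / k.factorial * y ^ k)
      (Real.exp (a * y) * ((1 - y) ^ n)⁻¹) := by
  have hA := hasSum_risingFac n h0 h1
  have hB : HasSum (fun j : ℕ => (a * y) ^ j / j.factorial) (Real.exp (a * y)) := by
    rw [Real.exp_eq_exp_ℝ]
    exact NormedSpace.expSeries_div_hasSum_exp (a * y)
  have h := hasSum_sum_range_mul_of_summable_norm hA.summable.norm hB.summable.norm
  rw [hA.tsum_eq, hB.tsum_eq] at h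
  refine h.of_eq (fun k => ?_) (mul_comm _ _)
  rw [Pba, Finset.sum_div, Finset.sum_mul]
  refine Finset.sum_congr rfl fun i hi => ?_
  have hi' : i ≤ k := Nat.lt_succ_iff.mp (Finset.mem_range.mp hi)
  rw [Nat.cast_choose ℝ hi', mul_pow]
  obtain ⟨j, rfl⟩ := Nat.exists_eq_add_of_le hi'
  have : (i.factorial : ℝ) ≠ 0 := by positivity
  have : ((i + j).factorial : ℝ) ≠ 0 := by positivity
  have : (j.factorial : ℝ) ≠ 0 := by positivity
  rw [Nat.add_sub_cancel_left, pow_add]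
  field_simp

lemma succ_mul_Pba_div_factorial (k n : ℕ) (a y : ℝ) :
    ((k + 1 : ℕ) : ℝ) * (Pba (k + 1) n a / (k + 1).factorial * y ^ (k + 1)) =
      n * y * (Pba k (n + 1) a / k.factorial * y ^ k) +
        a * y * (Pba k n a / k.factorial * y ^ k) := by
  have : (k.factorial : ℝ) ≠ 0 := by positivity
  rw [Pba_succ, Nat.factorial_succ]
  push_cast
  field_simp
  ring

lemma hasSum_mul_Pba (a : ℝ) (n : ℕ) {y : ℝ} (h0 : 0 ≤ y) (h1 : y < 1) :
    HasSum (fun k : ℕ => (k : ℝ) * (Pba k n a / k.factorial * y ^ k))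
      (n * y * (Real.exp (a * y) * ((1 - y) ^ (n + 1))⁻¹) +
        a * y * (Real.exp (a * y) * ((1 - y) ^ n)⁻¹)) := by
  rw [← hasSum_nat_add_iff' 1]
  simp only [succ_mul_Pba_div_factorial, Finset.range_one, Finset.sum_singleton, Nat.cast_zero,
    zero_mul, sub_zero]
  exact ((hasSum_Pba a (n + 1) h0 h1).mul_left _).add ((hasSum_Pba a n h0 h1).mul_left _)

lemma hasSum_sq_mul_Pba (a : ℝ) (n : ℕ) {y : ℝ} (h0 : 0 ≤ y) (h1 : y < 1) :
    HasSum (fun k : ℕ => (k : ℝ) ^ 2 * (Pba k n a / k.factorial * y ^ k))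
      (n * y * ((n + 1 : ℕ) * y * (Real.exp (a * y) * ((1 - y) ^ (n + 2))⁻¹) +
        a * y * (Real.exp (a * y) * ((1 - y) ^ (n + 1))⁻¹) +
        Real.exp (a * y) * ((1 - y) ^ (n + 1))⁻¹) +
      a * y * (n * y * (Real.exp (a * y) * ((1 - y) ^ (n + 1))⁻¹) +
        a * y * (Real.exp (a * y) * ((1 - y) ^ n)⁻¹) +
        Real.exp (a * y) * ((1 - y) ^ n)⁻¹)) := by
  rw [← hasSum_nat_add_iff' 1]
  simp only [Finset.range_one, Finset.sum_singleton, Nat.cast_zero, ne_eq, OfNat.ofNat_ne_zero,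
    not_false_eq_true, zero_pow, zero_mul, sub_zero]
  have h := (((hasSum_mul_Pba a (n + 1) h0 h1).add (hasSum_Pba a (n + 1) h0 h1)).mul_left
    (n * y)).add
    (((hasSum_mul_Pba a n h0 h1).add (hasSum_Pba a n h0 h1)).mul_left (a * y))
  refine h.of_eq (fun k => ?_) rfl
  rw [pow_two, mul_assoc, succ_mul_Pba_div_factorial]
  push_cast
  ring

lemma Wgb_eq (a : ℝ) (n k : ℕ) {x : ℝ} (hx : 0 ≤ x) :
    Wgb a n k x = Real.exp (-(a * (x / (1 + x)))) * (1 - x / (1 + x)) ^ n *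
      (Pba k n a / k.factorial * (x / (1 + x)) ^ k) := by
  have h : (1 : ℝ) + x ≠ 0 := by positivity
  have h' : 1 - x / (1 + x) = (1 + x)⁻¹ := by field_simp; ring
  rw [Wgb, h', show -(a * x) / (1 + x) = -(a * (x / (1 + x))) by ring, div_pow, pow_add, inv_pow]
  field_simp

lemma hasSum_Wgb (a : ℝ) (n : ℕ) {x : ℝ} (hx : 0 ≤ x) :
    HasSum (fun k => Wgb a n k x) 1 := by
  have h : (0 : ℝ) < 1 + x := by positivity
  have hy0 : 0 ≤ x / (1 + x) := by positivity
  have hy1 : x / (1 + x) < 1 := by rw [div_lt_one h]; linarith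
  have hne : 1 - x / (1 + x) ≠ 0 := by linarith
  simp only [Wgb_eq a n _ hx]
  refine ((hasSum_Pba a n hy0 hy1).mul_left _).of_eq (fun _ => rfl) ?_
  rw [Real.exp_neg]
  field_simp

lemma hasSum_mul_Wgb (a : ℝ) (n : ℕ) {x : ℝ} (hx : 0 ≤ x) :
    HasSum (fun k : ℕ => (k : ℝ) * Wgb a n k x) (n * x + a * (x / (1 + x))) := by
  have h : (0 : ℝ) < 1 + x := by positivity
  have hy0 : 0 ≤ x / (1 + x) := by positivity
  have hy1 : x / (1 + x) < 1 := by rw [div_lt_one h]; linarith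
  have h' : 1 - x / (1 + x) = (1 + x)⁻¹ := by field_simp; ring
  refine ((hasSum_mul_Pba a n hy0 hy1).mul_left
    (Real.exp (-(a * (x / (1 + x)))) * (1 - x / (1 + x)) ^ n)).of_eq
    (fun k => by rw [Wgb_eq a n k hx, mul_left_comm]) ?_
  simp only [Real.exp_neg, h', inv_pow, inv_inv]
  field_simp
  ring

lemma hasSum_sq_mul_Wgb (a : ℝ) (n : ℕ) {x : ℝ} (hx : 0 ≤ x) :
    HasSum (fun k : ℕ => (k : ℝ) ^ 2 * Wgb a n k x)
      ((n * x + a * (x / (1 + x))) ^ 2 + a * (x / (1 + x)) + n * x * (1 + x)) := by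
  have h : (0 : ℝ) < 1 + x := by positivity
  have hy0 : 0 ≤ x / (1 + x) := by positivity
  have hy1 : x / (1 + x) < 1 := by rw [div_lt_one h]; linarith
  have h' : 1 - x / (1 + x) = (1 + x)⁻¹ := by field_simp; ring
  refine ((hasSum_sq_mul_Pba a n hy0 hy1).mul_left
    (Real.exp (-(a * (x / (1 + x)))) * (1 - x / (1 + x)) ^ n)).of_eq
    (fun k => by rw [Wgb_eq a n k hx, mul_left_comm]) ?_
  simp only [Real.exp_neg, h', inv_pow, inv_inv]
  push_cast
  field_simp
  ring

lemma hasSum_sub_sq_mul_Wgb (a : ℝ) (n : ℕ) {x : ℝ} (hx : 0 ≤ x) :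
    HasSum (fun k : ℕ => ((k : ℝ) / (n + 1) - x) ^ 2 * Wgb a n k x)
      ((a * (x / (1 + x)) + n * x * (1 + x) + (a * (x / (1 + x)) - x) ^ 2) / (n + 1) ^ 2) := by
  have hn : (n : ℝ) + 1 ≠ 0 := by positivity
  refine ((((hasSum_sq_mul_Wgb a n hx).mul_left (1 / ((n : ℝ) + 1) ^ 2)).add
    ((hasSum_mul_Wgb a n hx).mul_left (-2 * x / (n + 1)))).add
    ((hasSum_Wgb a n hx).mul_left (x ^ 2))).of_eq (fun k => ?_) ?_
  · field_simp
    ring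
  · generalize x / (1 + x) = y
    field_simp
    ring

/-- The second central moment of the nodes `k/(n+1)` is `O((1+x²)/(n+1))`. -/
lemma Wgb_central_moment_le {a : ℝ} (ha : 0 ≤ a) (n : ℕ) {x : ℝ} (hx : 0 ≤ x) :
    (a * (x / (1 + x)) + n * x * (1 + x) + (a * (x / (1 + x)) - x) ^ 2) / ((n : ℝ) + 1) ^ 2 ≤
      (a + a ^ 2 + 3) * (1 + x ^ 2) / (n + 1) := by
  have h : (0 : ℝ) < 1 + x := by positivity
  have hy0 : 0 ≤ x / (1 + x) := by positivity
  have hy1 : x / (1 + x) ≤ 1 := by rw [div_le_one h]; linarith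
  have hn : (0 : ℝ) ≤ n := Nat.cast_nonneg n
  generalize x / (1 + x) = y at *
  have hay0 : 0 ≤ a * y := by positivity
  have hay1 : a * y ≤ a := mul_le_of_le_one_right ha hy1
  have h1 : (a * y - x) ^ 2 ≤ a ^ 2 + x ^ 2 := by
    nlinarith [pow_le_pow_left₀ hay0 hay1 2, mul_nonneg hay0 hx]
  have h2 : (n : ℝ) * x * (1 + x) ≤ n * (2 * (1 + x ^ 2)) := by
    rw [mul_assoc]
    exact mul_le_mul_of_nonneg_left (by nlinarith [sq_nonneg (x - 1)]) hn
  rw [div_le_div_iff₀ (by positivity) (by positivity), pow_two (n + 1 : ℝ), ← mul_assoc]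
  refine mul_le_mul_of_nonneg_right ?_ (by positivity)
  have h3 : 0 ≤ (a + a ^ 2) * (1 + x ^ 2) * n := by positivity
  have h4 : 0 ≤ (a + a ^ 2) * x ^ 2 := by positivity
  nlinarith [mul_nonneg hn (sq_nonneg x), sq_nonneg x]

/-- A weighted modulus-of-continuity bound: a continuous function on `[0,∞)` with a limit at
infinity relative to `1 + x²` deviates from its value at `x` by a small multiple of `1 + x²`,
up to a quadratic error. -/
lemma exists_abs_sub_le {f : ℝ → ℝ} (hcont : ContinuousOn f (Set.Ici 0)) {L : ℝ}
    (hlim : Tendsto (fun x : ℝ => f x / (1 + x ^ 2)) atTop (nhds L)) {ε : ℝ} (hε : 0 < ε) :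
    ∃ C : ℝ, 0 ≤ C ∧ ∀ t x : ℝ, 0 ≤ t → 0 ≤ x →
      |f t - f x| ≤ ε * (1 + x ^ 2) + C * (t - x) ^ 2 := by
  set h : ℝ → ℝ := fun t => f t - L * (1 + t ^ 2) with h_def
  have hh : ContinuousOn h (Set.Ici 0) := hcont.sub (by fun_prop)
  set η := ε / 6 with hη_def
  have hη : 0 < η := by positivity
  obtain ⟨R, hR0, hR⟩ : ∃ R : ℝ, 0 ≤ R ∧ ∀ t, R ≤ t → |h t| ≤ η * (1 + t ^ 2) := by
    obtain ⟨R, hR⟩ := (Metric.tendsto_atTop.mp hlim) η hη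
    refine ⟨max R 0, le_max_right _ _, fun t ht => ?_⟩
    have h1 := (hR t ((le_max_left _ _).trans ht)).le
    have hp : (0 : ℝ) < 1 + t ^ 2 := by positivity
    rw [Real.dist_eq, div_sub' hp.ne', abs_div, abs_of_pos hp, div_le_iff₀ hp] at h1
    simpa only [h_def, mul_comm L] using h1
  have hsub : Set.Icc 0 (R + 1) ⊆ Set.Ici (0 : ℝ) := Set.Icc_subset_Ici_self
  obtain ⟨B, hB⟩ := isCompact_Icc.exists_bound_of_continuousOn (hh.mono hsub)
  have hB0 : 0 ≤ B := (norm_nonneg _).trans (hB 0 ⟨le_rfl, by linarith⟩)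
  obtain ⟨δ, hδ, hunif⟩ := Metric.uniformContinuousOn_iff.mp
    (isCompact_Icc.uniformContinuousOn_of_continuous (hh.mono hsub)) η hη
  have hbound : ∀ t, 0 ≤ t → |h t| ≤ η * (1 + t ^ 2) + B := by
    intro t ht
    rcases le_total t (R + 1) with htR | htR
    · have := hB t ⟨ht, htR⟩
      rw [Real.norm_eq_abs] at this
      have : 0 ≤ η * (1 + t ^ 2) := by positivity
      linarith
    · linarith [hR t (by linarith)]
  set d := min δ 1 with hd_def
  have hd : 0 < d := lt_min hδ one_pos
  have key : ∀ t x : ℝ, 0 ≤ t → 0 ≤ x →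
      |h t - h x| ≤ η * (2 + t ^ 2 + x ^ 2) + 2 * B / d ^ 2 * (t - x) ^ 2 := by
    intro t x ht hx
    have hq : 0 ≤ 2 * B / d ^ 2 * (t - x) ^ 2 := by positivity
    have htri : |h t - h x| ≤ |h t| + |h x| := abs_sub _ _
    rcases lt_or_ge |t - x| d with htx | htx
    · have h1 := abs_lt.mp (htx.trans_le (min_le_right _ _))
      by_cases hc : t ≤ R + 1 ∧ x ≤ R + 1
      · have := (hunif t ⟨ht, hc.1⟩ x ⟨hx, hc.2⟩ (htx.trans_le (min_le_left _ _))).le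
        rw [Real.dist_eq] at this
        nlinarith [sq_nonneg t, sq_nonneg x]
      · have hRR : R ≤ t ∧ R ≤ x := by
          rw [not_and_or, not_le, not_le] at hc
          rcases hc with hc | hc <;> constructor <;> linarith
        linarith [hR t hRR.1, hR x hRR.2]
    · have h1 : d ^ 2 ≤ (t - x) ^ 2 := by
        rw [← sq_abs (t - x)]
        exact pow_le_pow_left₀ hd.le htx 2
      have h2 : 2 * B ≤ 2 * B / d ^ 2 * (t - x) ^ 2 := by
        rw [div_mul_eq_mul_div, le_div_iff₀ (by positivity)]
        exact mul_le_mul_of_nonneg_left h1 (by positivity)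
      linarith [hbound t ht, hbound x hx]
  refine ⟨2 * B / d ^ 2 + 2 * η + |L| + 2 * L ^ 2 / ε, by positivity, fun t x ht hx => ?_⟩
  have hsq : |L * (t ^ 2 - x ^ 2)| ≤
      |L| * (t - x) ^ 2 + ε / 2 * x ^ 2 + 2 * L ^ 2 / ε * (t - x) ^ 2 := by
    have e1 : L * (t ^ 2 - x ^ 2) = L * (t - x) ^ 2 + 2 * (L * (t - x)) * x := by ring
    have e2 : |L * (t - x) ^ 2| = |L| * (t - x) ^ 2 := by rw [abs_mul, abs_sq]
    have e3 : |2 * (L * (t - x)) * x| ≤ ε / 2 * x ^ 2 + 2 * L ^ 2 / ε * (t - x) ^ 2 := by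
      have p1 : ε / 2 * x ^ 2 + 2 * L ^ 2 / ε * (t - x) ^ 2 - 2 * (L * (t - x)) * x =
          (ε * x - 2 * (L * (t - x))) ^ 2 / (2 * ε) := by field_simp; ring
      have p2 : ε / 2 * x ^ 2 + 2 * L ^ 2 / ε * (t - x) ^ 2 + 2 * (L * (t - x)) * x =
          (ε * x + 2 * (L * (t - x))) ^ 2 / (2 * ε) := by field_simp; ring
      have q1 : 0 ≤ (ε * x - 2 * (L * (t - x))) ^ 2 / (2 * ε) := by positivity
      have q2 : 0 ≤ (ε * x + 2 * (L * (t - x))) ^ 2 / (2 * ε) := by positivity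
      rw [abs_le]
      constructor <;> linarith
    rw [e1]
    linarith [abs_add_le (L * (t - x) ^ 2) (2 * (L * (t - x)) * x)]
  have hf : f t - f x = (h t - h x) + L * (t ^ 2 - x ^ 2) := by simp only [h_def]; ring
  have ht2 : t ^ 2 ≤ 2 * x ^ 2 + 2 * (t - x) ^ 2 := by nlinarith [sq_nonneg (t - 2 * x)]
  have hηt := mul_le_mul_of_nonneg_left ht2 hη.le
  rw [hf]
  have hε6 : ε = 6 * η := by rw [hη_def]; ring
  have := abs_add_le (h t - h x) (L * (t ^ 2 - x ^ 2))
  have := key t x ht hx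
  nlinarith [mul_nonneg hη.le (sq_nonneg x)]

lemma abs_Kgb_sub_le {a : ℝ} (ha : 0 ≤ a) (n : ℕ) {f : ℝ → ℝ}
    (hcont : ContinuousOn f (Set.Ici 0)) {ε C x : ℝ} (hC : 0 ≤ C) (hx : 0 ≤ x)
    (hf : ∀ t, 0 ≤ t → |f t - f x| ≤ ε * (1 + x ^ 2) + C * (t - x) ^ 2) :
    |Kgb a n f x - f x| ≤
      (ε + 2 * C * (a + a ^ 2 + 4) / (n + 1)) * (1 + x ^ 2) := by
  set N : ℝ := (n : ℝ) + 1 with hN_def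
  have hN : 0 < N := by positivity
  have hN1 : 1 ≤ N := by simp [hN_def]
  set I : ℕ → ℝ := fun k => ∫ t in ((k : ℝ) / N)..(((k : ℝ) + 1) / N), f t with I_def
  set b : ℕ → ℝ := fun k =>
    (ε * (1 + x ^ 2) + 2 * C / N ^ 2) + 2 * C * ((k : ℝ) / N - x) ^ 2 with b_def
  have hlen : ∀ k : ℕ, ((k : ℝ) + 1) / N - (k : ℝ) / N = 1 / N := fun k => by ring
  have hle : ∀ k : ℕ, (k : ℝ) / N ≤ ((k : ℝ) + 1) / N := fun k => by gcongr; linarith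
  have hI : ∀ k, |N * I k - f x| ≤ b k := by
    intro k
    have hint : IntervalIntegrable f volume ((k : ℝ) / N) (((k : ℝ) + 1) / N) := by
      refine (hcont.mono ?_).intervalIntegrable
      rw [Set.uIcc_of_le (hle k)]
      exact fun t ht => le_trans (by positivity) ht.1
    have h1 : I k - f x / N = ∫ t in ((k : ℝ) / N)..(((k : ℝ) + 1) / N), (f t - f x) := by
      rw [intervalIntegral.integral_sub hint intervalIntegrable_const,
        intervalIntegral.integral_const, hlen, smul_eq_mul]
      ring
    have h2 : |I k - f x / N| ≤ b k * (1 / N) := by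
      rw [h1, ← Real.norm_eq_abs]
      refine (intervalIntegral.norm_integral_le_of_norm_le_const (C := b k) ?_).trans_eq ?_
      · intro t ht
        rw [Set.uIoc_of_le (hle k)] at ht
        have ht0 : 0 ≤ t := le_trans (by positivity) ht.1.le
        have hs : (t - k / N) ^ 2 ≤ (1 / N) ^ 2 :=
          pow_le_pow_left₀ (by linarith [ht.1]) (by linarith [ht.2, hlen k]) 2
        have hsq : (t - x) ^ 2 ≤ 2 * (1 / N) ^ 2 + 2 * ((k : ℝ) / N - x) ^ 2 := by
          nlinarith [sq_nonneg ((t - k / N) - (k / N - x))]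
        have h3 := mul_le_mul_of_nonneg_left hsq hC
        have h4 : 2 * C / N ^ 2 = C * (2 * (1 / N) ^ 2) := by field_simp
        rw [Real.norm_eq_abs]
        simp only [b_def]
        linarith [hf t ht0]
      · rw [hlen, abs_of_pos (by positivity)]
    have h5 : N * I k - f x = N * (I k - f x / N) := by field_simp
    rw [h5, abs_mul, abs_of_pos hN]
    calc N * |I k - f x / N| ≤ N * (b k * (1 / N)) := by gcongr
      _ = b k := by field_simp
  have hW := hasSum_Wgb a n hx
  have hWb : HasSum (fun k => b k * Wgb a n k x) ((ε * (1 + x ^ 2) + 2 * C / N ^ 2) * 1 + 2 * C *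
      ((a * (x / (1 + x)) + n * x * (1 + x) + (a * (x / (1 + x)) - x) ^ 2) / N ^ 2)) := by
    refine ((hW.mul_left (ε * (1 + x ^ 2) + 2 * C / N ^ 2)).add
      ((hasSum_sub_sq_mul_Wgb a n hx).mul_left (2 * C))).of_eq (fun k => ?_) rfl
    simp only [b_def]
    ring
  have hle' : ∀ k, ‖(N * I k - f x) * Wgb a n k x‖ ≤ b k * Wgb a n k x := fun k => by
    have := Wgb_nonneg ha n k hx
    rw [norm_mul, Real.norm_of_nonneg this, Real.norm_eq_abs]
    exact mul_le_mul_of_nonneg_right (hI k) this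
  have hsum : Summable fun k => (N * I k - f x) * Wgb a n k x :=
    Summable.of_norm_bounded hWb.summable hle'
  have hK : Kgb a n f x - f x = ∑' k, (N * I k - f x) * Wgb a n k x := by
    have h6 := hsum.hasSum.add (hW.mul_left (f x))
    have h7 : Kgb a n f x = ∑' k, N * (Wgb a n k x * I k) := by
      rw [tsum_mul_left]; rfl
    have h8 : (fun k => (N * I k - f x) * Wgb a n k x + f x * Wgb a n k x) =
        fun k => N * (Wgb a n k x * I k) := by ext k; ring
    rw [h8] at h6
    rw [h7, h6.tsum_eq]
    ring
  have hmom := mul_le_mul_of_nonneg_left (Wgb_central_moment_le ha n hx)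
    (show 0 ≤ 2 * C by positivity)
  have hN2 : 2 * C / N ^ 2 ≤ 2 * C / N * (1 + x ^ 2) := by
    have h9 : 2 * C / N ^ 2 ≤ 2 * C / N := by gcongr; nlinarith
    have : 0 ≤ 2 * C / N * x ^ 2 := by positivity
    linarith
  rw [hK, ← Real.norm_eq_abs]
  refine (tsum_of_norm_bounded hWb hle').trans ?_
  have h10 : (ε + 2 * C * (a + a ^ 2 + 4) / N) * (1 + x ^ 2) = ε * (1 + x ^ 2) +
      2 * C / N * (1 + x ^ 2) + 2 * C * ((a + a ^ 2 + 3) * (1 + x ^ 2) / N) := by ring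
  rw [h10]
  linarith

/-- weighted approximation theorem. -/
theorem statement4 (a M : ℝ) (ha : 0 ≤ a) (f : ℝ → ℝ)
    (hcont : ContinuousOn f (Set.Ici 0))
    (hgrow : ∀ x : ℝ, 0 ≤ x → |f x| ≤ M * (1 + x ^ 2))
    (hlim : ∃ L : ℝ, Tendsto (fun x : ℝ => f x / (1 + x ^ 2)) atTop (nhds L)) :
    Tendsto (fun n : ℕ => rhoNorm (fun x => Kgb a n f x - f x)) atTop (nhds 0) := by
  obtain ⟨L, hL⟩ := hlim
  rw [Metric.tendsto_atTop]
  intro ε hε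
  obtain ⟨C, hC, hf⟩ := exists_abs_sub_le hcont hL (show 0 < ε / 3 by positivity)
  obtain ⟨n₀, hn₀⟩ := exists_nat_gt (2 * C * (a + a ^ 2 + 4) / (ε / 3))
  refine ⟨n₀, fun n hn => ?_⟩
  have hsmall : 2 * C * (a + a ^ 2 + 4) / ((n : ℝ) + 1) ≤ ε / 3 := by
    have h1 : (n₀ : ℝ) ≤ n := by exact_mod_cast hn
    rw [div_lt_iff₀ (by positivity)] at hn₀
    rw [div_le_iff₀ (by positivity)]
    nlinarith
  have hnonneg : 0 ≤ rhoNorm (fun x => Kgb a n f x - f x) :=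
    Real.iSup_nonneg fun x => by positivity
  have hle : rhoNorm (fun x => Kgb a n f x - f x) ≤ ε / 3 + ε / 3 := by
    refine ciSup_le fun x => ?_
    have hx : (0 : ℝ) ≤ x := x.2
    rw [div_le_iff₀ (by positivity)]
    refine (abs_Kgb_sub_le ha n hcont hC hx fun t ht => hf t x ht hx).trans ?_
    gcongr
  rw [Real.dist_eq, sub_zero, abs_of_nonneg hnonneg]
  linarith
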